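/- For every 0 < α < 1 and 0 < ε < 1, the function θ(t) = t^α on [0,∞) satisfies |θ(t) − θ(at)| ≤ γ^{1/2} |1−a| θ(t) for all t ≥ 0 and a ≥ ε, where γ = ((1−ε^α)/(1−ε))², and moreover 0 < γ < 1. -/

import Mathlib

open Real

/-- The secant slope of `x ↦ x ^ α` from `1` is antitone, hence bounded on `[ε, ∞)` by its value
at `ε`. -/
lemma abs_one_sub_rpow_le {α ε a : ℝ} (hα0 : 0 < α) (hα1 : α < 1) (hε0 : 0 < ε) (hε1 : ε < 1)
    (ha : ε ≤ a) : |1 - a ^ α| ≤ (1 - ε ^ α) / (1 - ε) * |1 - a| := by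
  rcases eq_or_ne a 1 with rfl | ha1
  · simp
  have ha0 : 0 ≤ a := hε0.le.trans ha
  have hconv : ConvexOn ℝ (Set.Ici 0) fun x : ℝ ↦ -x ^ α :=
    (concaveOn_rpow hα0.le hα1.le).neg
  have h := hconv.secant_mono (a := 1) (x := ε) (y := a) (Set.mem_Ici.2 zero_le_one) hε0.le ha0
    hε1.ne ha1 ha
  simp only [one_rpow] at h
  have hε : (-ε ^ α - -1) / (ε - 1) = -((1 - ε ^ α) / (1 - ε)) := by
    rw [← neg_sub 1 ε, div_neg]
    ring
  rw [hε] at h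
  rcases ha1.lt_or_gt with h1 | h1
  · rw [abs_of_nonneg (sub_nonneg.2 (rpow_le_one ha0 h1.le hα0.le)), abs_of_pos (sub_pos.2 h1)]
    rw [le_div_iff_of_neg (sub_neg.2 h1)] at h
    linarith
  · rw [abs_of_nonpos (sub_nonpos.2 (one_le_rpow h1.le hα0.le)), abs_of_neg (sub_neg.2 h1)]
    rw [le_div_iff₀ (sub_pos.2 h1)] at h
    linarith

theorem stmt5
    (α ε : ℝ) (hα0 : 0 < α) (hα1 : α < 1) (hε0 : 0 < ε) (hε1 : ε < 1) :
    (0 < ((1 - ε ^ α) / (1 - ε)) ^ 2 ∧ ((1 - ε ^ α) / (1 - ε)) ^ 2 < 1) ∧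
    ∀ t a : ℝ, 0 ≤ t → ε ≤ a →
      |t ^ α - (a * t) ^ α|
        ≤ Real.sqrt (((1 - ε ^ α) / (1 - ε)) ^ 2) * |1 - a| * t ^ α := by
  have hpos : 0 < (1 - ε ^ α) / (1 - ε) :=
    div_pos (sub_pos.2 (rpow_lt_one hε0.le hε1 hα0)) (sub_pos.2 hε1)
  have hlt : (1 - ε ^ α) / (1 - ε) < 1 := by
    rw [div_lt_one (sub_pos.2 hε1)]
    have := rpow_lt_rpow_of_exponent_gt hε0 hε1 hα1
    rw [rpow_one] at this
    linarith
  refine ⟨⟨pow_pos hpos 2, pow_lt_one₀ hpos.le hlt two_ne_zero⟩, fun t a ht ha ↦ ?_⟩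
  have htα : 0 ≤ t ^ α := rpow_nonneg ht α
  rw [sqrt_sq hpos.le, mul_rpow (hε0.le.trans ha) ht, ← one_sub_mul, abs_mul, abs_of_nonneg htα]
  exact mul_le_mul_of_nonneg_right (abs_one_sub_rpow_le hα0 hα1 hε0 hε1 ha) htα
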